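/- Let G be a finite basic game with private values and full-support prior, and let φ ∈ Δ(A). Then the following are equivalent: (i) there exists σ : E → Δ(A) such that σ(a|ε) > 0 implies a is a pure strategy Nash equilibrium at ε, and φ(a) = ∑_{ε∈E} ψ(ε)·σ(a|ε) for all a ∈ A; (ii) there exists σ : E → Δ(A) such that (Obedience) for every i ∈ I, e_i ∈ E_i, a ∈ A and a_i' ∈ A_i, ∑_{ε∈E with ε_i = e_i} ψ(ε)·σ(a|ε)·(v_i((a_i',a_{-i}),e_i) − v_i(a,e_i)) ≤ 0, and (Consistency) φ(a) = ∑_{ε∈E} ψ(ε)·σ(a|ε) for all a ∈ A. (Paper's Corollary 2: linear programming characterization of the complete-information pure strategy Nash equilibrium identified set with arbitrary equilibrium selection.) -/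

import Mathlib

open Finset
open scoped Classical

noncomputable section

/-- `a` is a pure strategy Nash equilibrium action profile at state `ε` of the private
values game with payoffs `u_i(a,ε) = v_i(a,ε_i)`. -/
def IsPSNE {I : Type} {A Ei : I → Type}
    (v : ∀ i : I, (∀ j, A j) → Ei i → ℝ) (ε : ∀ j, Ei j) (a : ∀ j, A j) : Prop :=
  ∀ (i : I) (ai' : A i), v i (Function.update a i ai') (ε i) ≤ v i a (ε i)

/-- **Corollary 2 of the paper (linear programming characterization of the
complete-information pure strategy Nash equilibrium identified set).** A distribution
`φ ∈ Δ(A)` arises from some selection over pure strategy Nash equilibrium outcomes if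
and only if there is `σ : E → Δ(A)` satisfying the obedience inequalities and the
consistency condition. -/
theorem psne_selection_iff_lp {I : Type} {A Ei : I → Type}
    [Fintype I] [Nonempty I]
    [∀ i, Fintype (A i)] [∀ i, Nonempty (A i)]
    [∀ i, Fintype (Ei i)] [∀ i, Nonempty (Ei i)]
    (ψ : (∀ i, Ei i) → ℝ)
    (hψpos : ∀ ε, 0 < ψ ε) (hψsum : ∑ ε : ∀ i, Ei i, ψ ε = 1)
    (v : ∀ i : I, (∀ j, A j) → Ei i → ℝ)
    (φ : (∀ i, A i) → ℝ)
    (hφnn : ∀ a, 0 ≤ φ a) (hφsum : ∑ a : ∀ i, A i, φ a = 1) :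
    (∃ σ : (∀ i, Ei i) → (∀ i, A i) → ℝ,
        (∀ ε a, 0 ≤ σ ε a) ∧ (∀ ε, ∑ a : ∀ i, A i, σ ε a = 1) ∧
        (∀ ε a, 0 < σ ε a → IsPSNE v ε a) ∧
        ∀ a, φ a = ∑ ε : ∀ i, Ei i, ψ ε * σ ε a)
      ↔ (∃ σ : (∀ i, Ei i) → (∀ i, A i) → ℝ,
        (∀ ε a, 0 ≤ σ ε a) ∧ (∀ ε, ∑ a : ∀ i, A i, σ ε a = 1) ∧
        (∀ (i : I) (ei : Ei i) (a : ∀ j, A j) (ai' : A i),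
          ∑ ε ∈ Finset.univ.filter (fun ε : ∀ j, Ei j => ε i = ei),
            ψ ε * σ ε a * (v i (Function.update a i ai') ei - v i a ei) ≤ 0) ∧
        ∀ a, φ a = ∑ ε : ∀ i, Ei i, ψ ε * σ ε a) := by
  constructor
  · rintro ⟨σ, h0, h1, h2, h3⟩
    refine ⟨σ, h0, h1, ?_, h3⟩
    intro i ei a ai'
    apply Finset.sum_nonpos
    intro ε hε
    have hi : ε i = ei := (Finset.mem_filter.mp hε).2
    rcases (h0 ε a).eq_or_lt with h | h
    · rw [← h]; simp
    · have := h2 ε a h i ai'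
      rw [hi] at this
      exact mul_nonpos_of_nonneg_of_nonpos (mul_nonneg (hψpos ε).le (h0 ε a)) (by linarith)
  · rintro ⟨σ, h0, h1, h2, h3⟩
    refine ⟨σ, h0, h1, ?_, h3⟩
    intro ε a hpos i ai'
    have h := h2 i (ε i) a ai'
    rw [← Finset.sum_mul] at h
    have hs : 0 < ∑ ε' ∈ Finset.univ.filter (fun ε' : ∀ j, Ei j => ε' i = ε i),
        ψ ε' * σ ε' a := by
      apply Finset.sum_pos'
      · intro ε' _
        exact mul_nonneg (hψpos ε').le (h0 ε' a)
      · exact ⟨ε, by simp, mul_pos (hψpos ε) hpos⟩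
    by_contra hc
    have hc' := not_le.mp hc
    have := mul_pos hs (sub_pos.mpr hc')
    linarith
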